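/- Let n ∈ ℕ, β > 0 and t > 0. For x ∈ [0,∞) let η_{t,x} be the measure on [0,∞) with density y ↦ p^D(t,x,y/√2)/√2 + 2 g_{0,√2β}(t, x + y/√2) with respect to Lebesgue measure plus the atom √2 β g_{0,√2β}(t,x) · δ₀ at 0. Then for every bounded Borel measurable function f : [0,∞)ⁿ → ℝ, the function x = (x₁,…,xₙ) ↦ ∫ f(y₁,…,yₙ) ∏_{i=1}^n η_{t,x_i}(dy_i) is bounded and continuous on [0,∞)ⁿ. (Strong Feller property of n independent sticky Brownian motions.) -/

import Mathlib

open Real Set MeasureTheory Filter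

/-- The complementary error function `erfc(u) = (2/√π) ∫_u^∞ e^{-z²} dz`. -/
noncomputable def erfc (u : ℝ) : ℝ :=
  (2 / Real.sqrt Real.pi) * ∫ z in Set.Ioi u, Real.exp (-z ^ 2)

/-- `g_{0,γ}(t,x) = (1/γ) exp(2x/γ + 2t/γ²) erfc(x/√(2t) + √(2t)/γ)`. -/
noncomputable def g0 (γ t x : ℝ) : ℝ :=
  (1 / γ) * Real.exp (2 * x / γ + 2 * t / γ ^ 2) *
    erfc (x / Real.sqrt (2 * t) + Real.sqrt (2 * t) / γ)

/-- The Gaussian heat kernel `p(t,x,y) = (2πt)^{-1/2} e^{-(x-y)²/(2t)}`. -/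
noncomputable def heatK (t x y : ℝ) : ℝ :=
  (Real.sqrt (2 * Real.pi * t))⁻¹ * Real.exp (-(x - y) ^ 2 / (2 * t))

/-- The heat kernel with Dirichlet boundary condition at `0`:
`p^D(t,x,y) = p(t,x,y) − p(t,x,−y)`. -/
noncomputable def pD (t x y : ℝ) : ℝ :=
  heatK t x y - heatK t x (-y)

/-- The absolutely continuous part of the sticky Brownian transition kernel:
`y ↦ p^D(t,x,y/√2)/√2 + 2 g_{0,√2β}(t, x + y/√2)`. -/
noncomputable def stickyDens (β t x y : ℝ) : ℝ :=
  pD t x (y / Real.sqrt 2) / Real.sqrt 2 + 2 * g0 (Real.sqrt 2 * β) t (x + y / Real.sqrt 2)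

/-- The transition kernel `η_{t,x}` of sticky Brownian motion on `[0,∞)` started at `x`:
the measure with density `stickyDens β t x` with respect to Lebesgue measure on `(0,∞)`
plus the atom `√2 β g_{0,√2β}(t,x)` at `0`. -/
noncomputable def stickyKernel (β t x : ℝ) : Measure ℝ :=
  (volume.restrict (Set.Ioi (0 : ℝ))).withDensity
      (fun y => ENNReal.ofReal (stickyDens β t x y))
    + ENNReal.ofReal (Real.sqrt 2 * β * g0 (Real.sqrt 2 * β) t x) • Measure.dirac 0

/-- The product of the measures with integrable densities `g i` has density `∏ i, g i (x i)`
with respect to the product measure. -/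
theorem pi_withDensity_ofReal {ι : Type*} [Fintype ι] {α : ι → Type*}
    [∀ i, MeasurableSpace (α i)] (μ : ∀ i, Measure (α i)) [∀ i, SigmaFinite (μ i)]
    (g : ∀ i, α i → ℝ) (hg : ∀ i, Integrable (g i) (μ i)) (hg0 : ∀ i a, 0 ≤ g i a) :
    Measure.pi (fun i => (μ i).withDensity fun a => ENNReal.ofReal (g i a)) =
      (Measure.pi μ).withDensity fun x => ENNReal.ofReal (∏ i, g i (x i)) := by
  refine Measure.pi_eq fun s hs => ?_
  rw [withDensity_apply _ (MeasurableSet.univ_pi hs), Measure.restrict_pi_pi,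
    ← ofReal_integral_eq_lintegral_ofReal
      (Integrable.fintype_prod_dep fun i => (hg i).restrict)
      (ae_of_all _ fun x => Finset.prod_nonneg fun i _ => hg0 i (x i)),
    integral_fintype_prod_eq_prod,
    ENNReal.ofReal_prod_of_nonneg fun i _ => integral_nonneg (hg0 i)]
  refine Finset.prod_congr rfl fun i _ => ?_
  rw [withDensity_apply _ (hs i),
    ofReal_integral_eq_lintegral_ofReal (hg i).restrict (ae_of_all _ (hg0 i))]

theorem integrable_exp_neg_sq : Integrable fun z : ℝ => Real.exp (-z ^ 2) := by
  simpa using integrable_exp_neg_mul_sq (b := 1) one_pos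

@[fun_prop]
theorem continuous_erfc : Continuous erfc := by
  have h : erfc = fun u => (2 / Real.sqrt Real.pi) *
      ((∫ z in Set.Ioi (0 : ℝ), Real.exp (-z ^ 2)) - ∫ z in (0 : ℝ)..u, Real.exp (-z ^ 2)) := by
    ext u
    rw [erfc, ← intervalIntegral.integral_Ioi_sub_Ioi' integrable_exp_neg_sq.integrableOn
      integrable_exp_neg_sq.integrableOn, sub_sub_cancel]
  rw [h]
  exact continuous_const.mul (continuous_const.sub
    (intervalIntegral.continuous_primitive (fun a b => integrable_exp_neg_sq.intervalIntegrable) 0))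

theorem erfc_le_exp_neg_sq {u : ℝ} (hu : 0 ≤ u) : erfc u ≤ Real.exp (-u ^ 2) := by
  have hshift : ∫ z in Set.Ioi u, Real.exp (-z ^ 2) =
      ∫ z in Set.Ioi (0 : ℝ), Real.exp (-(z + u) ^ 2) := by
    simpa using ((measurePreserving_add_right volume u).setIntegral_preimage_emb
      (measurableEmbedding_addRight u) (fun z : ℝ => Real.exp (-z ^ 2)) (Set.Ioi u)).symm
  have hle : ∫ z in Set.Ioi (0 : ℝ), Real.exp (-(z + u) ^ 2) ≤
      ∫ z in Set.Ioi (0 : ℝ), Real.exp (-u ^ 2) * Real.exp (-z ^ 2) := by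
    refine setIntegral_mono_on (integrable_exp_neg_sq.comp_add_right u).integrableOn
      (integrable_exp_neg_sq.const_mul _).integrableOn measurableSet_Ioi fun z hz => ?_
    rw [← Real.exp_add]
    have : 0 ≤ z * u := mul_nonneg (le_of_lt hz) hu
    exact Real.exp_le_exp.2 (by nlinarith)
  have hgauss : ∫ z in Set.Ioi (0 : ℝ), Real.exp (-z ^ 2) = Real.sqrt Real.pi / 2 := by
    simpa using integral_gaussian_Ioi 1
  rw [integral_const_mul, hgauss] at hle
  have hpi : 0 < Real.sqrt Real.pi := Real.sqrt_pos.2 Real.pi_pos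
  calc erfc u ≤ 2 / Real.sqrt Real.pi * (Real.exp (-u ^ 2) * (Real.sqrt Real.pi / 2)) := by
        rw [erfc, hshift]; gcongr
    _ = Real.exp (-u ^ 2) := by field_simp

@[fun_prop]
theorem continuous_g0 (γ t : ℝ) : Continuous (g0 γ t) := by
  unfold g0; fun_prop

theorem g0_le {γ t x : ℝ} (hγ : 0 < γ) (ht : 0 < t) (hx : 0 ≤ x) :
    g0 γ t x ≤ 1 / γ * Real.exp (-x ^ 2 / (2 * t)) := by
  have hs : 0 < Real.sqrt (2 * t) := Real.sqrt_pos.2 (by positivity)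
  have hsq : Real.sqrt (2 * t) ^ 2 = 2 * t := Real.sq_sqrt (by positivity)
  have h := erfc_le_exp_neg_sq (u := x / Real.sqrt (2 * t) + Real.sqrt (2 * t) / γ) (by positivity)
  calc g0 γ t x ≤ 1 / γ * Real.exp (2 * x / γ + 2 * t / γ ^ 2) *
        Real.exp (-(x / Real.sqrt (2 * t) + Real.sqrt (2 * t) / γ) ^ 2) := by
        unfold g0; gcongr
    _ = 1 / γ * Real.exp (-x ^ 2 / (2 * t)) := by
        rw [mul_assoc, ← Real.exp_add, add_sq, div_pow, div_pow, hsq]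
        congr 2
        field_simp
        ring

/-- Lebesgue measure on `(0,∞)` plus a unit atom at `0`, with respect to which all the measures
`η_{t,x}` are absolutely continuous. -/
noncomputable def stickyRef : Measure ℝ :=
  volume.restrict (Set.Ioi (0 : ℝ)) + Measure.dirac 0

instance : SigmaFinite stickyRef := by
  unfold stickyRef; infer_instance

theorem ae_stickyRef_nonneg : ∀ᵐ y ∂stickyRef, 0 ≤ y := by
  rw [stickyRef, ae_add_measure_iff]
  exact ⟨(ae_restrict_mem measurableSet_Ioi).mono fun y hy => le_of_lt hy, by simp⟩

theorem integrable_stickyRef {h : ℝ → ℝ} (hh : Integrable h) : Integrable h stickyRef :=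
  hh.restrict.add_measure (integrable_dirac (by simp))

theorem integral_stickyRef_le {h : ℝ → ℝ} (hh : Integrable h) (h0 : ∀ y, 0 ≤ h y) :
    ∫ y, h y ∂stickyRef ≤ (∫ y, h y) + h 0 := by
  rw [stickyRef, integral_add_measure hh.restrict (integrable_dirac (by simp)), integral_dirac]
  gcongr
  · exact ae_of_all _ h0
  · exact Measure.restrict_le_self

/-- The density of `η_{t,x}` with respect to `stickyRef`. -/
noncomputable def stickyRefDens (β t x y : ℝ) : ℝ :=
  max (if y = 0 then Real.sqrt 2 * β * g0 (Real.sqrt 2 * β) t x else stickyDens β t x y) 0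

theorem stickyRefDens_nonneg (β t x y : ℝ) : 0 ≤ stickyRefDens β t x y :=
  le_max_right _ _

theorem continuous_stickyDens_left (β t y : ℝ) : Continuous fun x => stickyDens β t x y := by
  unfold stickyDens pD heatK; fun_prop

theorem continuous_stickyDens_right (β t x : ℝ) : Continuous (stickyDens β t x) := by
  unfold stickyDens pD heatK; fun_prop

theorem continuous_stickyRefDens_left (β t y : ℝ) :
    Continuous fun x => stickyRefDens β t x y := by
  unfold stickyRefDens
  have := continuous_stickyDens_left β t y
  split_ifs <;> fun_prop

theorem measurable_stickyRefDens (β t x : ℝ) : Measurable (stickyRefDens β t x) :=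
  (Measurable.ite (measurableSet_singleton 0) measurable_const
    (continuous_stickyDens_right β t x).measurable).max measurable_const

theorem measurable_prod_stickyRefDens {n : ℕ} (β t : ℝ) (x : Fin n → ℝ) :
    Measurable fun y : Fin n → ℝ => ∏ i, stickyRefDens β t (x i) (y i) :=
  Finset.measurable_prod _ fun i _ =>
    (measurable_stickyRefDens β t (x i)).comp (measurable_pi_apply i)

theorem continuous_prod_stickyRefDens {n : ℕ} (β t : ℝ) (y : Fin n → ℝ) :
    Continuous fun x : Fin n → ℝ => ∏ i, stickyRefDens β t (x i) (y i) :=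
  continuous_finsetProd _ fun i _ =>
    (continuous_stickyRefDens_left β t (y i)).comp (continuous_apply i)

theorem stickyKernel_eq_withDensity (β t x : ℝ) :
    stickyKernel β t x =
      stickyRef.withDensity fun y => ENNReal.ofReal (stickyRefDens β t x y) := by
  rw [stickyRef, withDensity_add_measure, dirac_withDensity, stickyKernel]
  congr 1
  · refine withDensity_congr_ae ?_
    filter_upwards [ae_restrict_mem measurableSet_Ioi] with y hy
    rw [stickyRefDens, if_neg (ne_of_gt hy), ENNReal.ofReal_max, ENNReal.ofReal_zero,
      max_eq_left zero_le]
  · simp [stickyRefDens, ENNReal.ofReal_max]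

theorem heatK_div_sqrt_two (t x y : ℝ) :
    heatK t x (y / Real.sqrt 2) = (Real.sqrt (2 * Real.pi * t))⁻¹ *
      Real.exp (-(1 / (4 * t)) * (y - Real.sqrt 2 * x) ^ 2) := by
  have h2 : Real.sqrt 2 ^ 2 = 2 := Real.sq_sqrt (by norm_num)
  have hs : Real.sqrt 2 ≠ 0 := by positivity
  have hx : x - y / Real.sqrt 2 = -((y - Real.sqrt 2 * x) / Real.sqrt 2) := by field_simp; ring
  rw [heatK, hx, neg_sq, div_pow, h2]
  congr 2
  rcases eq_or_ne t 0 with rfl | ht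
  · simp
  · field_simp; ring

theorem stickyRefDens_le {β t x y : ℝ} (hβ : 0 < β) (ht : 0 < t) (hx : 0 ≤ x) (hy : 0 ≤ y) :
    stickyRefDens β t x y ≤
      (Real.sqrt (2 * Real.pi * t))⁻¹ * Real.exp (-(1 / (4 * t)) * (y - Real.sqrt 2 * x) ^ 2) +
        (2 * (1 / (Real.sqrt 2 * β)) + 1) * Real.exp (-(1 / (4 * t)) * y ^ 2) := by
  have hγ : 0 < Real.sqrt 2 * β := by positivity
  refine max_le ?_ (by positivity)
  split_ifs with h
  · subst h
    have hg := g0_le hγ ht hx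
    have hle : Real.exp (-x ^ 2 / (2 * t)) ≤ 1 :=
      Real.exp_le_one_iff.2 (div_nonpos_of_nonpos_of_nonneg (by nlinarith [sq_nonneg x])
        (by positivity))
    have hone : Real.sqrt 2 * β * g0 (Real.sqrt 2 * β) t x ≤ 1 := by
      calc Real.sqrt 2 * β * g0 (Real.sqrt 2 * β) t x
          ≤ Real.sqrt 2 * β * (1 / (Real.sqrt 2 * β) * 1) := by gcongr; exact hg.trans (by gcongr)
        _ = 1 := by field_simp
    refine hone.trans ?_
    have h1 : 0 ≤ (Real.sqrt (2 * Real.pi * t))⁻¹ *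
      Real.exp (-(1 / (4 * t)) * (0 - Real.sqrt 2 * x) ^ 2) := by positivity
    have h2 : 0 ≤ 2 * (1 / (Real.sqrt 2 * β)) := by positivity
    simp only [ne_eq, OfNat.ofNat_ne_zero, not_false_eq_true, zero_pow, mul_zero, Real.exp_zero,
      mul_one]
    linarith
  · have hheat : pD t x (y / Real.sqrt 2) / Real.sqrt 2 ≤ heatK t x (y / Real.sqrt 2) := by
      have h0 : 0 ≤ heatK t x (-(y / Real.sqrt 2)) := by unfold heatK; positivity
      have h1 : 0 ≤ heatK t x (y / Real.sqrt 2) := by unfold heatK; positivity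
      calc pD t x (y / Real.sqrt 2) / Real.sqrt 2
          ≤ heatK t x (y / Real.sqrt 2) / Real.sqrt 2 := by
            unfold pD; gcongr; linarith
        _ ≤ heatK t x (y / Real.sqrt 2) :=
            div_le_self h1 (Real.one_le_sqrt.2 (by norm_num))
    have hg : g0 (Real.sqrt 2 * β) t (x + y / Real.sqrt 2) ≤
        1 / (Real.sqrt 2 * β) * Real.exp (-(1 / (4 * t)) * y ^ 2) := by
      refine (g0_le hγ ht (by positivity)).trans ?_
      gcongr
      have hsq : (y / Real.sqrt 2) ^ 2 ≤ (x + y / Real.sqrt 2) ^ 2 := by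
        gcongr; linarith
      rw [div_pow, Real.sq_sqrt (by norm_num)] at hsq
      calc -(x + y / Real.sqrt 2) ^ 2 / (2 * t) ≤ -(y ^ 2 / 2) / (2 * t) := by gcongr
        _ = -(1 / (4 * t)) * y ^ 2 := by field_simp; ring
    rw [stickyDens, ← heatK_div_sqrt_two]
    have := Real.exp_pos (-(1 / (4 * t)) * y ^ 2)
    linarith

/-- Local uniform Gaussian domination of the transition densities. -/
theorem stickyRefDens_le_gaussian {β t R x y : ℝ} (hβ : 0 < β) (ht : 0 < t) (hx : 0 ≤ x)
    (hxR : x ≤ R) (hy : 0 ≤ y) :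
    stickyRefDens β t x y ≤
      ((Real.sqrt (2 * Real.pi * t))⁻¹ * Real.exp (R ^ 2 / (2 * t)) +
        (2 * (1 / (Real.sqrt 2 * β)) + 1)) * Real.exp (-(1 / (8 * t)) * y ^ 2) := by
  refine (stickyRefDens_le hβ ht hx hy).trans ?_
  rw [add_mul (_ * Real.exp (R ^ 2 / (2 * t))), mul_assoc _ (Real.exp (R ^ 2 / (2 * t))),
    ← Real.exp_add]
  gcongr ?_ * Real.exp ?_ + ?_ * Real.exp ?_
  · have h2 : Real.sqrt 2 ^ 2 = 2 := Real.sq_sqrt (by norm_num)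
    have hxx : x ^ 2 ≤ R ^ 2 := by gcongr
    have key : y ^ 2 / 2 - 2 * R ^ 2 ≤ (y - Real.sqrt 2 * x) ^ 2 := by
      nlinarith [sq_nonneg (y - 2 * (Real.sqrt 2 * x))]
    calc -(1 / (4 * t)) * (y - Real.sqrt 2 * x) ^ 2
        ≤ -(1 / (4 * t)) * (y ^ 2 / 2 - 2 * R ^ 2) :=
          mul_le_mul_of_nonpos_left key (by simp; positivity)
      _ = R ^ 2 / (2 * t) + -(1 / (8 * t)) * y ^ 2 := by field_simp; ring
  · gcongr
    norm_num

theorem exists_integrable_stickyRefDens_le {β t : ℝ} (hβ : 0 < β) (ht : 0 < t) (R : ℝ) :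
    ∃ D : ℝ → ℝ, Integrable D stickyRef ∧
      ∀ {x y : ℝ}, 0 ≤ x → x ≤ R → 0 ≤ y → stickyRefDens β t x y ≤ D y :=
  ⟨_, integrable_stickyRef ((integrable_exp_neg_mul_sq (by positivity)).const_mul _),
    fun hx hxR hy => stickyRefDens_le_gaussian hβ ht hx hxR hy⟩

theorem integrable_stickyRefDens {β t x : ℝ} (hβ : 0 < β) (ht : 0 < t) (hx : 0 ≤ x) :
    Integrable (stickyRefDens β t x) stickyRef := by
  obtain ⟨D, hD, hle⟩ := exists_integrable_stickyRefDens_le hβ ht x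
  refine hD.mono' (measurable_stickyRefDens β t x).aestronglyMeasurable ?_
  filter_upwards [ae_stickyRef_nonneg] with y hy
  rw [Real.norm_of_nonneg (stickyRefDens_nonneg _ _ _ _)]
  exact hle hx le_rfl hy

theorem exists_integral_stickyRefDens_le {β t : ℝ} (hβ : 0 < β) (ht : 0 < t) :
    ∃ K : ℝ, ∀ x, 0 ≤ x → ∫ y, stickyRefDens β t x y ∂stickyRef ≤ K := by
  set G : ℝ → ℝ := fun y => Real.exp (-(1 / (4 * t)) * y ^ 2) with hG
  have hGi : Integrable G := integrable_exp_neg_mul_sq (by positivity)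
  set A := (Real.sqrt (2 * Real.pi * t))⁻¹
  set B := 2 * (1 / (Real.sqrt 2 * β)) + 1
  have hA : 0 ≤ A := by positivity
  have hB : 0 ≤ B := by positivity
  have hG0 : ∀ y, 0 ≤ G y := fun y => (Real.exp_pos _).le
  have hG1 : ∀ y, G y ≤ 1 := fun y => Real.exp_le_one_iff.2 <| by
    rw [neg_mul, neg_nonpos]; positivity
  refine ⟨A * (∫ y, G y) + B * (∫ y, G y) + (A + B), fun x hx => ?_⟩
  have h1 : Integrable fun y => A * G (y - Real.sqrt 2 * x) :=
    (hGi.comp_sub_right _).const_mul A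
  have h2 : Integrable fun y => B * G y := hGi.const_mul B
  calc ∫ y, stickyRefDens β t x y ∂stickyRef
      ≤ ∫ y, (A * G (y - Real.sqrt 2 * x) + B * G y) ∂stickyRef := by
        refine integral_mono_ae (integrable_stickyRefDens hβ ht hx)
          (integrable_stickyRef (h1.add h2)) ?_
        filter_upwards [ae_stickyRef_nonneg] with y hy
        exact stickyRefDens_le hβ ht hx hy
    _ ≤ (∫ y, (A * G (y - Real.sqrt 2 * x) + B * G y)) +
          (A * G (0 - Real.sqrt 2 * x) + B * G 0) :=
        integral_stickyRef_le (h1.add h2) fun y =>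
          add_nonneg (mul_nonneg hA (hG0 _)) (mul_nonneg hB (hG0 _))
    _ ≤ A * (∫ y, G y) + B * (∫ y, G y) + (A + B) := by
        rw [integral_add h1 h2, integral_const_mul, integral_const_mul,
          integral_sub_right_eq_self G]
        gcongr
        · exact mul_le_of_le_one_right hA (hG1 _)
        · exact mul_le_of_le_one_right hB (hG1 _)

theorem ae_pi_stickyRef_mem (n : ℕ) :
    ∀ᵐ y ∂(Measure.pi fun _ : Fin n => stickyRef),
      y ∈ Set.univ.pi (fun _ : Fin n => Set.Ici (0 : ℝ)) :=
  (eventually_all.2 fun i : Fin n => (Measure.tendsto_eval_ae_ae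
    (μ := fun _ : Fin n => stickyRef) (i := i)).eventually ae_stickyRef_nonneg).mono
      fun _ hy i _ => hy i

theorem integral_pi_stickyKernel {n : ℕ} {β t : ℝ} (hβ : 0 < β) (ht : 0 < t)
    (f : (Fin n → ℝ) → ℝ) {x : Fin n → ℝ} (hx : ∀ i, 0 ≤ x i) :
    ∫ y, f y ∂(Measure.pi fun i => stickyKernel β t (x i)) =
      ∫ y, (∏ i, stickyRefDens β t (x i) (y i)) * f y ∂(Measure.pi fun _ => stickyRef) := by
  simp_rw [stickyKernel_eq_withDensity]
  rw [pi_withDensity_ofReal (fun _ => stickyRef) (fun i => stickyRefDens β t (x i))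
    (fun i => integrable_stickyRefDens hβ ht (hx i)) (fun i => stickyRefDens_nonneg β t (x i)),
    integral_withDensity_eq_integral_toReal_smul
      (measurable_prod_stickyRefDens β t x).ennreal_ofReal
      (ae_of_all _ fun _ => ENNReal.ofReal_lt_top)]
  refine integral_congr_ae (ae_of_all _ fun y => ?_)
  simp only [smul_eq_mul]
  rw [ENNReal.toReal_ofReal (Finset.prod_nonneg fun i _ => stickyRefDens_nonneg _ _ _ _)]

/-- Strong Feller property of `n` independent sticky Brownian motions: for `β, t > 0` and
every bounded Borel measurable `f : [0,∞)ⁿ → ℝ`, the function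
`x ↦ ∫ f(y) ∏ᵢ η_{t,xᵢ}(dyᵢ)` is bounded and continuous on `[0,∞)ⁿ`. -/
theorem stickyP_n_strong_feller (n : ℕ) (β t : ℝ) (hβ : 0 < β) (ht : 0 < t)
    (f : (Fin n → ℝ) → ℝ) (hf : Measurable f) (C : ℝ)
    (hfC : ∀ y ∈ Set.univ.pi (fun _ : Fin n => Set.Ici (0 : ℝ)), |f y| ≤ C) :
    (∃ M : ℝ, ∀ x ∈ Set.univ.pi (fun _ : Fin n => Set.Ici (0 : ℝ)),
        |∫ y, f y ∂(Measure.pi fun i => stickyKernel β t (x i))| ≤ M) ∧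
      ContinuousOn (fun x : Fin n → ℝ => ∫ y, f y ∂(Measure.pi fun i => stickyKernel β t (x i)))
        (Set.univ.pi (fun _ : Fin n => Set.Ici (0 : ℝ))) := by
  have hC : 0 ≤ C := (abs_nonneg _).trans (hfC 0 fun _ _ => Set.self_mem_Ici)
  have hnorm : ∀ x y : Fin n → ℝ, y ∈ Set.univ.pi (fun _ : Fin n => Set.Ici (0 : ℝ)) →
      ‖(∏ i, stickyRefDens β t (x i) (y i)) * f y‖ ≤
        (∏ i, stickyRefDens β t (x i) (y i)) * C := fun x y hy => by
    have hprod := Finset.prod_nonneg (s := Finset.univ)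
      fun i _ => stickyRefDens_nonneg β t (x i) (y i)
    rw [norm_mul, Real.norm_of_nonneg hprod]
    exact mul_le_mul_of_nonneg_left (hfC y hy) hprod
  constructor
  · obtain ⟨K, hK⟩ := exists_integral_stickyRefDens_le hβ ht
    refine ⟨K ^ n * C, fun x hx => ?_⟩
    have hx0 : ∀ i, 0 ≤ x i := fun i => hx i (mem_univ i)
    rw [integral_pi_stickyKernel hβ ht f hx0, ← Real.norm_eq_abs]
    calc ‖∫ y, (∏ i, stickyRefDens β t (x i) (y i)) * f y ∂(Measure.pi fun _ => stickyRef)‖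
        ≤ ∫ y, (∏ i, stickyRefDens β t (x i) (y i)) * C ∂(Measure.pi fun _ => stickyRef) :=
          norm_integral_le_of_norm_le
            ((Integrable.fintype_prod fun i =>
              integrable_stickyRefDens hβ ht (hx0 i)).mul_const C)
            ((ae_pi_stickyRef_mem n).mono fun y hy => hnorm x y hy)
      _ = (∏ i, ∫ y, stickyRefDens β t (x i) y ∂stickyRef) * C := by
          rw [integral_mul_const, integral_fintype_prod_eq_prod]
      _ ≤ (∏ _i : Fin n, K) * C := by
          gcongr with i
          · exact fun i _ => integral_nonneg (stickyRefDens_nonneg β t (x i))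
          · exact hK _ (hx0 i)
      _ = K ^ n * C := by simp
  · suffices h : ContinuousOn (fun x : Fin n → ℝ =>
        ∫ y, (∏ i, stickyRefDens β t (x i) (y i)) * f y ∂(Measure.pi fun _ : Fin n => stickyRef))
        (Set.univ.pi (fun _ : Fin n => Set.Ici (0 : ℝ))) by
      refine h.congr fun x hx => ?_
      have hx0 : ∀ i, 0 ≤ x i := fun i => hx i (mem_univ i)
      exact integral_pi_stickyKernel hβ ht f hx0
    intro x₀ _
    obtain ⟨D, hD, hle⟩ := exists_integrable_stickyRefDens_le hβ ht (‖x₀‖ + 1)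
    have hDprod : Integrable (fun y : Fin n → ℝ => ∏ i, D (y i))
        (Measure.pi fun _ : Fin n => stickyRef) :=
      Integrable.fintype_prod (f := fun _ => D) (μ := fun _ => stickyRef) fun _ => hD
    have hcont : ∀ y : Fin n → ℝ, ContinuousWithinAt
        (fun x : Fin n → ℝ => (∏ i, stickyRefDens β t (x i) (y i)) * f y)
        (Set.univ.pi (fun _ : Fin n => Set.Ici (0 : ℝ))) x₀ := fun y =>
      ((continuous_prod_stickyRefDens β t y).mul continuous_const).continuousWithinAt
    refine continuousWithinAt_of_dominated
      (F := fun x y : Fin n → ℝ => (∏ i, stickyRefDens β t (x i) (y i)) * f y)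
      (bound := fun y => (∏ i, D (y i)) * C)
      (Eventually.of_forall fun x =>
        ((measurable_prod_stickyRefDens β t x).mul hf).aestronglyMeasurable) ?_
      (hDprod.mul_const C) (ae_of_all _ hcont)
    filter_upwards [self_mem_nhdsWithin,
      mem_nhdsWithin_of_mem_nhds (Metric.ball_mem_nhds x₀ one_pos)] with x hx hxb
    filter_upwards [ae_pi_stickyRef_mem n] with y hy
    refine (hnorm x y hy).trans ?_
    gcongr with i
    · exact fun i _ => stickyRefDens_nonneg _ _ _ _
    · refine hle (hx i (mem_univ i)) ?_ (hy i (mem_univ i))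
      have h1 : ‖x - x₀‖ < 1 := mem_ball_iff_norm.1 hxb
      have h2 : ‖x‖ ≤ ‖x₀‖ + ‖x - x₀‖ := norm_le_insert' x x₀
      have h3 : x i ≤ ‖x‖ := (le_abs_self _).trans (norm_le_pi_norm x i)
      linarith
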